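/- (Pieri rule of Lenart, bijectively reproved) For every partition λ and all integers ℓ ≥ 1 and m ≥ 1, the identity G_{(1^ℓ)}(x_1,…,x_m)·G_λ(x_1,…,x_m) = Σ_ν (−1)^{|ν/λ|−ℓ}·C(c(ν/λ)−1, |ν/λ|−ℓ)·G_ν(x_1,…,x_m) holds in ℤ[x_1,…,x_m], where the sum is over all partitions ν with at most m rows such that λ ⊊ ν, ν/λ is a vertical strip and |ν/λ| ≥ ℓ; here c(ν/λ) is the number of nonempty columns of ν/λ and C(·,·) is the binomial coefficient. -/

import Mathlib

open MvPolynomial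

/-- A set-valued tableau on an arbitrary finite set of boxes `(row, column)`.
Entries are `0`-based: the entry `i : ℕ` stands for the integer `i + 1`
(equivalently, for the variable `x_{i+1}`).  Rows weakly increase from left to
right and columns strictly increase from top to bottom, expressed via
horizontally and vertically adjacent boxes. -/
structure SVT (cells : Finset (ℕ × ℕ)) where
  entry : ℕ × ℕ → Finset ℕ
  nonempty_of_mem : ∀ c ∈ cells, (entry c).Nonempty
  eq_empty_of_not_mem : ∀ c, c ∉ cells → entry c = ∅
  row_weak : ∀ i j, (i, j) ∈ cells → (i, j + 1) ∈ cells →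
    ∀ a ∈ entry (i, j), ∀ b ∈ entry (i, j + 1), a ≤ b
  col_strict : ∀ i j, (i, j) ∈ cells → (i + 1, j) ∈ cells →
    ∀ a ∈ entry (i, j), ∀ b ∈ entry (i + 1, j), a < b

namespace SVT

variable {cells : Finset (ℕ × ℕ)}

/-- `|T|`: the total number of integers in the boxes of `T`. -/
def size (T : SVT cells) : ℕ := ∑ c ∈ cells, (T.entry c).card

/-- `T` has all its entries among `{1, …, m}` (i.e. `0`-based entries `< m`). -/
def Bounded (T : SVT cells) (m : ℕ) : Prop := ∀ c, ∀ x ∈ T.entry c, x < m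

/-- The monomial `x^T`, where the exponent of the variable `i` is the number of
boxes of `T` containing `i`. -/
noncomputable def monomial (T : SVT cells) : MvPolynomial ℕ ℤ :=
  ∏ c ∈ cells, ∏ i ∈ T.entry c, X i

/-- The column word of `T`: columns are read from left to right, each column
from bottom to top, the integers within a box in increasing order. -/
def word (T : SVT cells) : List ℕ :=
  (List.range ((cells.sup fun c => max c.1 c.2) + 1)).flatMap fun j =>
    ((List.range ((cells.sup fun c => max c.1 c.2) + 1)).reverse).flatMap fun i =>
      (T.entry (i, j)).sort (· ≤ ·)

end SVT

/-- The stable Grothendieck polynomial of the shape given by `cells`, in the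
variables `x_1, …, x_m` (`0`-based: variables `0, …, m-1`):
`G(cells) = ∑_T (-1)^(|T| - #cells) x^T` over set-valued tableaux `T` of shape
`cells` with entries in `{1, …, m}`. -/
noncomputable def grothendieck (cells : Finset (ℕ × ℕ)) (m : ℕ) : MvPolynomial ℕ ℤ :=
  ∑ᶠ (T : SVT cells) (_ : T.Bounded m), ((-1 : ℤ) ^ (T.size - cells.card)) • T.monomial

/-- A reverse lattice word: every suffix contains, for each `i`, at least as
many occurrences of `i` as of `i + 1`. -/
def IsRLW (w : List ℕ) : Prop := ∀ s, s <:+ w → ∀ i, s.count (i + 1) ≤ s.count i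

/-- A partial reverse lattice word with respect to the (`0`-based, half-open)
interval `[a, b)`:  every suffix contains, for each `t` with `a ≤ t` and
`t + 1 < b`, at least as many occurrences of `t` as of `t + 1`. -/
def IsPartialRLW (a b : ℕ) (w : List ℕ) : Prop :=
  ∀ s, s <:+ w → ∀ t, a ≤ t → t + 1 < b → s.count (t + 1) ≤ s.count t

/-- `w` has content `ν`: the number of occurrences of `i` in `w` is the length
of the `i`-th row of `ν`. -/
def HasContent (w : List ℕ) (nu : YoungDiagram) : Prop := ∀ i, w.count i = nu.rowLen i

/-- The cells of the skew diagram `λ * μ`, obtained by placing `λ` and `μ`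
corner to corner: `λ` occupies rows `0, …, ℓ(λ)-1` shifted right by `μ₁`
columns, and `μ` occupies the rows below row `ℓ(λ)-1`. -/
def starCells (lam mu : YoungDiagram) : Finset (ℕ × ℕ) :=
  (lam.cells.image fun c => (c.1, c.2 + mu.rowLen 0)) ∪
    (mu.cells.image fun c => (c.1 + lam.colLen 0, c.2))

/-- The structure constant `c^ν_{λμ}`: `(-1)^(|ν|-|λ|-|μ|)` times the number of
set-valued tableaux of shape `λ * μ` whose word is a reverse lattice word with
content `ν`. -/
noncomputable def cLR (lam mu nu : YoungDiagram) : ℤ :=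
  (-1 : ℤ) ^ (nu.card - lam.card - mu.card) *
    (Nat.card {T : SVT (starCells lam mu) // IsRLW T.word ∧ HasContent T.word nu} : ℤ)

/-- The coproduct structure constant `d^ν_{λμ}`: `(-1)^(|λ|+|μ|-|ν|)` times the
number of set-valued tableaux of shape `ν` whose word is a partial reverse
lattice word with respect to both intervals `[1, ℓ(λ)]` and
`[ℓ(λ)+1, ℓ(λ)+ℓ(μ)]` and has content `(λ₁, …, λ_{ℓ(λ)}, μ₁, …, μ_{ℓ(μ)})`. -/
noncomputable def dCoeff (lam mu nu : YoungDiagram) : ℤ :=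
  (-1 : ℤ) ^ (lam.card + mu.card - nu.card) *
    (Nat.card {T : SVT nu.cells //
      IsPartialRLW 0 (lam.colLen 0) T.word ∧
      IsPartialRLW (lam.colLen 0) (lam.colLen 0 + mu.colLen 0) T.word ∧
      ∀ i, T.word.count i =
        if i < lam.colLen 0 then lam.rowLen i else mu.rowLen (i - lam.colLen 0)} : ℤ)

/-- The coefficient `α_{θ,μ}` for a shape `θ` given by `cells`:
`(-1)^(|μ|-|θ|)` times the number of set-valued tableaux of shape `θ` whose
word is a reverse lattice word with content `μ`. -/
noncomputable def alphaCoeff (cells : Finset (ℕ × ℕ)) (mu : YoungDiagram) : ℤ :=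
  (-1 : ℤ) ^ (mu.card - cells.card) *
    (Nat.card {T : SVT cells // IsRLW T.word ∧ HasContent T.word mu} : ℤ)

/-- `ν/λ` is a vertical strip: at most one box in each row. -/
def IsVerticalStrip (lam nu : YoungDiagram) : Prop := ∀ i, nu.rowLen i ≤ lam.rowLen i + 1

/-- `ν/λ` is a horizontal strip: at most one box in each column. -/
def IsHorizontalStrip (lam nu : YoungDiagram) : Prop := ∀ j, nu.colLen j ≤ lam.colLen j + 1

/-- A set of boxes is a rook strip if it has at most one box in each row and in
each column. -/
def IsRookStripCells (s : Finset (ℕ × ℕ)) : Prop :=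
  (∀ i, (s.filter fun c => c.1 = i).card ≤ 1) ∧ (∀ j, (s.filter fun c => c.2 = j).card ≤ 1)

/-- The rectangular Young diagram with `p` rows and `q` columns. -/
def rect (p q : ℕ) : YoungDiagram :=
  ⟨Finset.range p ×ˢ Finset.range q, by
    intro a b hba ha
    simp only [Finset.coe_product, Set.mem_prod, Finset.mem_coe, Finset.mem_range] at ha ⊢
    exact ⟨lt_of_le_of_lt hba.1 ha.1, lt_of_le_of_lt hba.2 ha.2⟩⟩

section Transfer

variable {A : Type*} [CommRing A]

/-- Row factor of a one-variable branching step: `a`, `c` are consecutive outer row lengths and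
`b` is an inner row length interlacing them. -/
def branchFactor (x : A) (a b c : ℕ) : A :=
  if c ≤ b ∧ b ≤ a then x ^ (a - b) * (if c < b then 1 - x else 1) else 0

/-- Row factor of a vertical strip: the row grows from `a` to `b`, the previous row grew from
`p` to `q`.  A new box has weight `s` if it is the topmost new box of its column and `1 + s`
otherwise. -/
def stripFactor (s : A) (p q a b : ℕ) : A :=
  if b = a then 1
  else if b = a + 1 then (if p = a then (if q = a + 1 then 1 + s else 0) else s)
  else 0

/-- Row factor of a vertical strip in the first row. -/
def stripStart (s : A) (a b : ℕ) : A :=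
  if b = a then 1 else if b = a + 1 then s else 0

/-- Partial transfer-matrix sums with states in `{0, …, n - 1}`. -/
def transfer (n : ℕ) (start : ℕ → A) (step : ℕ → ℕ → ℕ → A) : ℕ → ℕ → A
  | 0, y => start y
  | k + 1, y => ∑ z ∈ Finset.range n, transfer n start step k z * step k z y

theorem sum_fin_eq_sum_transfer (n : ℕ) (start : ℕ → A) (step : ℕ → ℕ → ℕ → A) (k : ℕ)
    (e : ℕ → A) :
    ∑ f : Fin (k + 1) → Fin n,
      start (f 0) * (∏ i : Fin k, step i (f i.castSucc) (f i.succ)) * e (f (Fin.last k)) =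
    ∑ y ∈ Finset.range n, transfer n start step k y * e y := by
  induction k generalizing e with
  | zero =>
    rw [← Fin.sum_univ_eq_sum_range (fun y => transfer n start step 0 y * e y)]
    exact Fintype.sum_equiv (Equiv.funUnique (Fin 1) (Fin n)) _ _ (fun f => by
      simp [transfer])
  | succ k ih =>
    rw [← (Fin.snocEquiv (fun _ : Fin (k + 2) => Fin n)).sum_comp, Fintype.sum_prod_type,
      Finset.sum_comm]
    have h := ih (fun z => ∑ y : Fin n, step k z y * e y)
    calc _ = ∑ f : Fin (k + 1) → Fin n, start (f 0) *
          (∏ i : Fin k, step i (f i.castSucc) (f i.succ)) *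
            ∑ y : Fin n, step k (f (Fin.last k)) y * e y := by
          refine Finset.sum_congr rfl fun f _ => ?_
          rw [Finset.mul_sum]
          refine Finset.sum_congr rfl fun y _ => ?_
          have h0 : (Fin.snoc f y : Fin (k + 2) → Fin n) 0 = f 0 :=
            Fin.snoc_castSucc (α := fun _ => Fin n) y f 0
          have hs : ∀ i : Fin k, (Fin.snoc f y : Fin (k + 2) → Fin n) i.castSucc.succ =
              f i.succ := fun i => Fin.snoc_castSucc (α := fun _ => Fin n) y f i.succ
          simp only [Fin.snocEquiv_apply, Fin.prod_univ_castSucc, Fin.snoc_castSucc, h0, hs,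
            Fin.snoc_last, Fin.succ_last, Fin.val_castSucc, Fin.val_last]
          ring
      _ = _ := by
          rw [h]
          simp only [transfer, Finset.sum_mul, Finset.mul_sum]
          simp only [fun z => Fin.sum_univ_eq_sum_range
            (fun y => transfer n start step k z * (step k z y * e y)) n]
          rw [Finset.sum_comm]
          simp only [mul_assoc]

theorem stripFactor_ne_zero {s : A} {p q a b : ℕ} (h : stripFactor s p q a b ≠ 0) :
    b = a ∨ b = a + 1 := by
  unfold stripFactor at h
  by_contra! h'
  simp [h'] at h

theorem stripStart_ne_zero {s : A} {a b : ℕ} (h : stripStart s a b ≠ 0) :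
    b = a ∨ b = a + 1 := by
  unfold stripStart at h
  by_contra! h'
  simp [h'] at h

/-- Transfer sums over vertical strips `ν / λ` followed by a branching step `ν → κ`. -/
def stripBranch (n : ℕ) (x s : A) (lam kap : ℕ → ℕ) : ℕ → ℕ → A :=
  transfer n (stripStart s (lam 0)) fun i z y =>
    stripFactor s (lam i) z (lam (i + 1)) y * branchFactor x z (kap i) y

/-- Transfer sums over branching steps `λ → μ` followed by vertical strips `κ / μ`. -/
def branchStrip (n : ℕ) (x s : A) (lam kap : ℕ → ℕ) : ℕ → ℕ → A :=
  transfer n (fun y => stripStart s y (kap 0)) fun i z y =>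
    branchFactor x (lam i) z (lam (i + 1)) * stripFactor s z (kap i) y (kap (i + 1))

theorem branchFactor_eq_zero {x : A} {a b c : ℕ} (h : b < c ∨ a < b) :
    branchFactor x a b c = 0 := if_neg (by omega)

theorem transfer_step_total (x s p q : A) (r : ℕ → A) (a b a' b' : ℕ) (hlk : a' ≤ a) (hkk : b' ≤ b)
   (hc : p + x * q = (1 + x * s) * r b) (hd : b = a + 1 → q = r a)
   (he : ∀ y, y + 1 = b → b ≤ a → r y = s * r b) :
    p * (stripFactor s a a a' a' * branchFactor x a b a') +
        q * (stripFactor s a (a + 1) a' a' * branchFactor x (a + 1) b a') +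
      x * (p * (stripFactor s a a a' (a' + 1) * branchFactor x a b (a' + 1)) +
        q * (stripFactor s a (a + 1) a' (a' + 1) * branchFactor x (a + 1) b (a' + 1))) =
    (1 + x * s) * (r b * (branchFactor x a b a' * stripFactor s b b b' b') +
        (if b = 0 then 0
          else r (b - 1) * (branchFactor x a (b - 1) a' * stripFactor s (b - 1) b b' b'))) := by
  have hs : ∀ p q c, stripFactor s p q c c = 1 := fun p q c => if_pos rfl
  simp only [hs, one_mul, mul_one]
  rcases lt_trichotomy b (a + 1) with h | h | h
  · have hba : b ≤ a := by omega
    obtain ⟨e, rfl⟩ := Nat.exists_eq_add_of_le hba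
    rcases lt_or_ge b a' with h1 | h1
    · simp [branchFactor_eq_zero (Or.inl h1), branchFactor_eq_zero (Or.inl (h1.trans (Nat.lt_succ_self _))), branchFactor_eq_zero (Or.inl (lt_of_le_of_lt (Nat.sub_le b 1) h1))]
    · rcases h1.eq_or_lt with rfl | h1
      · rcases a' with _ | c
        · simp [branchFactor]; linear_combination x^e * hc
        · simp [branchFactor]
          have : c+1+e-c = e + 1 := by omega
          rw [this, if_pos (by omega)]
          linear_combination x^e * hc
      · obtain ⟨c, rfl⟩ : ∃ c, b = c + 1 := ⟨b - 1, by omega⟩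
        have he' := he c rfl hba
        have e1 : c + 1 + e + 1 - (c + 1) = e + 1 := by omega
        have e2 : c + 1 + e - c = e + 1 := by omega
        have e3 : a' ≤ c := by omega
        rcases e3.eq_or_lt with rfl | h2
        · simp [branchFactor, stripFactor, e1, e2, he']
          split_ifs <;> first | omega | linear_combination (1 + x * s - x) * x^e * hc
        · have f1 : a' ≤ c + 1 := by omega
          have f2 : a' < c + 1 := by omega
          have f3 : a' < c + 1 + e := by omega
          simp [branchFactor, stripFactor, e1, e2, he', f1, f2, h2, h2.le, f3.ne', show c ≤ c + 1 + e by omega]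
          linear_combination (1 - x) * (1 + x * s) * x^e * hc
  · subst h
    have hq := hd rfl
    simp [branchFactor, stripFactor, hq]
    rcases hlk.eq_or_lt with rfl | h1
    · simp; ring
    · simp [h1, h1.le, show a' ≤ a + 1 by omega, h1.ne']; ring
  · simp [branchFactor_eq_zero (Or.inr h), branchFactor_eq_zero (Or.inr (show a < b by omega)), branchFactor_eq_zero (Or.inr (show a < b - 1 by omega))]

theorem transfer_step_top (x s p q : A) (r : ℕ → A) (a b a' b' : ℕ) (hlk : a' ≤ a) (hkk : b' ≤ b)
   (hc : p + x * q = (1 + x * s) * r b) (hd : b = a + 1 → q = r a)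
   (he : ∀ y, y + 1 = b → b ≤ a → r y = s * r b) (hb' : b' = a' + 1) :
    p * (stripFactor s a a a' (a' + 1) * branchFactor x a b (a' + 1)) +
        q * (stripFactor s a (a + 1) a' (a' + 1) * branchFactor x (a + 1) b (a' + 1)) =
    r b * (branchFactor x a b a' * stripFactor s b b a' b') +
        (if b = 0 then 0
          else r (b - 1) * (branchFactor x a (b - 1) a' * stripFactor s (b - 1) b a' b')) := by
  subst hb'
  obtain ⟨c, rfl⟩ : ∃ c, b = c + 1 := ⟨b - 1, by omega⟩
  rw [if_neg (by omega), Nat.add_sub_cancel]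
  have e3 : a' ≤ c := by omega
  rcases lt_trichotomy (c + 1) (a + 1) with h | h | h
  · obtain ⟨e, rfl⟩ := Nat.exists_eq_add_of_le (show c + 1 ≤ a by omega)
    have he' := he c rfl (by omega)
    have e1 : c + 1 + e + 1 - (c + 1) = e + 1 := by omega
    have e2 : c + 1 + e - c = e + 1 := by omega
    have f1 : a' ≤ c + 1 := by omega
    have f2 : a' < c + 1 := by omega
    have f3 : a' < c + 1 + e := by omega
    rcases e3.eq_or_lt with rfl | h2
    · simp [branchFactor, stripFactor, e2, he', show a' ≤ a' + 1 + e by omega, show a' + 1 + e ≠ a' by omega]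
      linear_combination s * x^e * hc
    · simp [branchFactor, stripFactor, e2, he', f1, f2, h2, h2.le, f3.ne', f2.ne', h2.ne', show c ≤ c + 1 + e by omega]
      linear_combination (1 - x) * s * x^e * hc
  · obtain rfl : c = a := by omega
    have hq := hd rfl
    rcases e3.eq_or_lt with rfl | h2
    · simp [branchFactor, stripFactor, hq]
    · simp [branchFactor, stripFactor, hq, h2, h2.le, h2.ne', show a' ≤ c + 1 by omega]; try ring
  · simp [branchFactor_eq_zero (Or.inr h), branchFactor_eq_zero (Or.inr (show a < c + 1 by omega)), branchFactor_eq_zero (Or.inr (show a < c by omega))]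

theorem transfer_step_strip (x s : A) (r : ℕ → A) (a b a' b' : ℕ) (hkk : b' ≤ b) (y : ℕ) (hy : y + 1 = b')
   (hb' : b' ≤ a') :
    (r b * (branchFactor x a b a' * stripFactor s b b y b') +
        (if b = 0 then 0
          else r (b - 1) * (branchFactor x a (b - 1) a' * stripFactor s (b - 1) b y b'))) =
   s * (r b * (branchFactor x a b a' * stripFactor s b b b' b') +
        (if b = 0 then 0
          else r (b - 1) * (branchFactor x a (b - 1) a' * stripFactor s (b - 1) b b' b'))) := by
  have key : ∀ z, branchFactor x a z a' * stripFactor s z b y b' =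
      s * (branchFactor x a z a' * stripFactor s z b b' b') := by
    intro z
    rcases lt_or_ge z a' with h | h
    · simp [branchFactor_eq_zero (Or.inl h)]
    · subst hy
      simp [stripFactor, show z ≠ y by omega, mul_comm]
  rw [key, key]
  split_ifs <;> ring

section Commutation

variable {n : ℕ} {x s : A} {lam kap : ℕ → ℕ}

theorem stripBranch_ne_zero {k y : ℕ} (h : stripBranch n x s lam kap k y ≠ 0) :
    y = lam k ∨ y = lam k + 1 := by
  cases k with
  | zero => exact stripStart_ne_zero h
  | succ k =>
    obtain ⟨z, -, hz⟩ : ∃ z ∈ Finset.range n, _ := Finset.exists_ne_zero_of_sum_ne_zero h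
    exact stripFactor_ne_zero (left_ne_zero_of_mul (right_ne_zero_of_mul hz))

theorem branchStrip_ne_zero {k y : ℕ} (h : branchStrip n x s lam kap k y ≠ 0) :
    kap k = y ∨ kap k = y + 1 := by
  cases k with
  | zero => exact stripStart_ne_zero h
  | succ k =>
    obtain ⟨z, -, hz⟩ : ∃ z ∈ Finset.range n, _ := Finset.exists_ne_zero_of_sum_ne_zero h
    exact stripFactor_ne_zero (right_ne_zero_of_mul (right_ne_zero_of_mul hz))

theorem sum_stripBranch_mul {k : ℕ} (hk : lam k + 1 < n) (g : ℕ → A) :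
    ∑ z ∈ Finset.range n, stripBranch n x s lam kap k z * g z =
      stripBranch n x s lam kap k (lam k) * g (lam k) +
        stripBranch n x s lam kap k (lam k + 1) * g (lam k + 1) := by
  refine Finset.sum_eq_add (lam k) (lam k + 1) (by omega) ?_ ?_ ?_
  · rintro c - ⟨h1, h2⟩
    by_contra h
    rcases stripBranch_ne_zero (left_ne_zero_of_mul h) with h | h <;> contradiction
  · intro h; simp at h; omega
  · intro h; simp at h; omega

theorem sum_branchStrip_mul {k : ℕ} (hk : kap k < n) (g : ℕ → A) :
    ∑ z ∈ Finset.range n, branchStrip n x s lam kap k z * g z =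
      branchStrip n x s lam kap k (kap k) * g (kap k) +
        (if kap k = 0 then 0
          else branchStrip n x s lam kap k (kap k - 1) * g (kap k - 1)) := by
  split_ifs with h0
  · rw [add_zero]
    refine Finset.sum_eq_single _ ?_ ?_
    · rintro c - h1
      by_contra h
      rcases branchStrip_ne_zero (left_ne_zero_of_mul h) with h | h <;> omega
    · intro h; simp at h; omega
  · refine Finset.sum_eq_add (kap k) (kap k - 1) (by omega) ?_ ?_ ?_
    · rintro c - ⟨h1, h2⟩
      by_contra h
      rcases branchStrip_ne_zero (left_ne_zero_of_mul h) with h | h <;> omega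
    · intro h; simp at h; omega
    · intro h; simp at h; omega

theorem transfer_invariant (hlam : Antitone lam) (hkap : Antitone kap) (hl : lam 0 + 1 < n)
    (hk : kap 0 < n) (k : ℕ) :
    (stripBranch n x s lam kap k (lam k) + x * stripBranch n x s lam kap k (lam k + 1) =
      (1 + x * s) * branchStrip n x s lam kap k (kap k)) ∧
    (kap k = lam k + 1 →
      stripBranch n x s lam kap k (lam k + 1) = branchStrip n x s lam kap k (lam k)) ∧
    (∀ y, y + 1 = kap k → kap k ≤ lam k →
      branchStrip n x s lam kap k y = s * branchStrip n x s lam kap k (kap k)) := by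
  induction k with
  | zero =>
    refine ⟨?_, ?_, ?_⟩
    · simp [stripBranch, branchStrip, transfer, stripStart]
    · intro h
      simp [stripBranch, branchStrip, transfer, stripStart, h]
    · intro y h1 h2
      simp [branchStrip, transfer, stripStart, ← h1]
  | succ k ih =>
    obtain ⟨hc, hd, he⟩ := ih
    have hL : ∀ y, stripBranch n x s lam kap (k + 1) y = _ := fun y =>
      sum_stripBranch_mul (x := x) (s := s) (lam := lam) (kap := kap) (k := k) (n := n)
        (by have := hlam (Nat.zero_le k); omega)
        (fun z => stripFactor s (lam k) z (lam (k + 1)) y * branchFactor x z (kap k) y)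
    have hR : ∀ y, branchStrip n x s lam kap (k + 1) y = _ := fun y =>
      sum_branchStrip_mul (x := x) (s := s) (lam := lam) (kap := kap) (k := k) (n := n)
        (by have := hkap (Nat.zero_le k); omega)
        (fun z => branchFactor x (lam k) z (lam (k + 1)) *
          stripFactor s z (kap k) y (kap (k + 1)))
    have hlk := hlam (Nat.le_succ k)
    have hkk := hkap (Nat.le_succ k)
    simp only [Nat.succ_eq_add_one] at hlk hkk
    simp only [hL, hR]
    generalize stripBranch n x s lam kap k (lam k) = p at *
    generalize stripBranch n x s lam kap k (lam k + 1) = q at *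
    generalize branchStrip n x s lam kap k = r at *
    generalize lam (k + 1) = a' at *
    generalize kap (k + 1) = b' at *
    generalize lam k = a at *
    generalize kap k = b at *
    clear hL hR
    refine ⟨transfer_step_total x s p q r a b a' b' hlk hkk hc hd he,
      transfer_step_top x s p q r a b a' b' hlk hkk hc hd he,
      fun y => transfer_step_strip x s r a b a' b' hkk y⟩

end Commutation
end Transfer

section Diagrams

theorem rowLen_injective : Function.Injective YoungDiagram.rowLen := by
  intro μ ν h
  ext ⟨i, j⟩
  simp [YoungDiagram.mem_iff_lt_rowLen, h]

theorem le_iff_rowLen_le {μ ν : YoungDiagram} : μ ≤ ν ↔ ∀ i, μ.rowLen i ≤ ν.rowLen i := by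
  rw [← YoungDiagram.cells_subset_iff]
  constructor
  · intro h i
    by_contra! hlt
    have := h ((YoungDiagram.mem_cells (i, ν.rowLen i)).2 (YoungDiagram.mem_iff_lt_rowLen.2 hlt))
    simp [YoungDiagram.mem_iff_lt_rowLen] at this
  · rintro h ⟨i, j⟩ hc
    simp only [YoungDiagram.mem_cells, YoungDiagram.mem_iff_lt_rowLen] at hc ⊢
    exact hc.trans_le (h i)

theorem rowLen_antitone (μ : YoungDiagram) : Antitone μ.rowLen := fun i j h => μ.rowLen_anti i j h

theorem rowLen_eq_zero_iff {μ : YoungDiagram} {i : ℕ} : μ.rowLen i = 0 ↔ μ.colLen 0 ≤ i := by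
  rw [← not_lt, ← YoungDiagram.mem_iff_lt_colLen, YoungDiagram.mem_iff_lt_rowLen]
  omega

/-- The Young diagram with the given row lengths, cut to a `K × N` box. -/
def diagramOfRows (K N : ℕ) (g : ℕ → ℕ) (hg : Antitone g) : YoungDiagram where
  cells := (Finset.range K ×ˢ Finset.range N).filter fun c => c.2 < g c.1
  isLowerSet := by
    intro a b hba ha
    have h1 : b.1 ≤ a.1 := hba.1
    have h2 : b.2 ≤ a.2 := hba.2
    have h3 := hg h1
    simp only [Finset.coe_filter, Finset.mem_product, Finset.mem_range, Set.mem_ofPred_eq] at ha ⊢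
    omega

theorem rowLen_diagramOfRows {K N : ℕ} {g : ℕ → ℕ} (hg : Antitone g) (hK : ∀ i, K ≤ i → g i = 0)
    (hN : g 0 ≤ N) : (diagramOfRows K N g hg).rowLen = g := by
  funext i
  refine eq_of_forall_lt_iff fun j => ?_
  rw [← YoungDiagram.mem_iff_lt_rowLen, ← YoungDiagram.mem_cells]
  simp only [diagramOfRows, Finset.mem_filter, Finset.mem_product, Finset.mem_range]
  have := hg (Nat.zero_le i)
  have := hK i
  omega

theorem finite_diagrams_in_box (K N : ℕ) :
    {ν : YoungDiagram | ν.rowLen K = 0 ∧ ν.rowLen 0 ≤ N}.Finite := by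
  refine Set.Finite.of_finite_image (f := YoungDiagram.cells)
    (((Finset.range K ×ˢ Finset.range N).powerset.finite_toSet).subset ?_)
    (fun _ _ _ _ h => YoungDiagram.ext h)
  rintro _ ⟨ν, ⟨hK, hN⟩, rfl⟩
  simp only [Finset.coe_powerset, Set.mem_preimage, Set.mem_powerset_iff, Finset.coe_subset]
  rintro ⟨i, j⟩ hc
  rw [YoungDiagram.mem_cells, YoungDiagram.mem_iff_lt_rowLen] at hc
  simp only [Finset.mem_product, Finset.mem_range]
  have := rowLen_antitone ν (Nat.zero_le i)
  refine ⟨?_, by omega⟩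
  by_contra! h
  have := rowLen_antitone ν h
  omega

/-- The Young diagrams with at most `K` rows and at most `N` columns. -/
noncomputable def youngBox (K N : ℕ) : Finset YoungDiagram := (finite_diagrams_in_box K N).toFinset

theorem mem_youngBox {K N : ℕ} {ν : YoungDiagram} :
    ν ∈ youngBox K N ↔ ν.rowLen K = 0 ∧ ν.rowLen 0 ≤ N := by simp [youngBox]

variable {A : Type*} [CommRing A]

theorem sum_youngBox (k N : ℕ) (F : (ℕ → ℕ) → A)
    (hF : ∀ g, (∀ i, k + 1 ≤ i → g i = 0) → F g ≠ 0 → Antitone g) :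
    ∑ ν ∈ youngBox (k + 1) N, F ν.rowLen =
      ∑ f : Fin (k + 1) → Fin (N + 1), F fun i => if h : i < k + 1 then f ⟨i, h⟩ else 0 := by
  have hext : ∀ ν ∈ youngBox (k + 1) N,
      (fun i => if i < k + 1 then ((Fin.ofNat (N + 1) (ν.rowLen i) : Fin (N + 1)) : ℕ) else 0) =
        ν.rowLen := by
    intro ν hν
    rw [mem_youngBox] at hν
    funext i
    have h0 := rowLen_antitone ν (Nat.zero_le i)
    split_ifs with h
    · simpa using Nat.mod_eq_of_lt (by omega : ν.rowLen i < N + 1)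
    · have := rowLen_antitone ν (not_lt.1 h)
      omega
  refine Finset.sum_of_injOn (fun ν i => Fin.ofNat (N + 1) (ν.rowLen i)) ?_ (by simp) ?_ ?_
  · intro μ hμ ν hν h
    apply rowLen_injective
    rw [← hext μ hμ, ← hext ν hν]
    funext i
    split_ifs with hi
    · exact congrArg Fin.val (congrFun h ⟨i, hi⟩)
    · rfl
  · intro f _ hf
    by_contra hne
    have hz : ∀ i, k + 1 ≤ i → (if h : i < k + 1 then (f ⟨i, h⟩ : ℕ) else 0) = 0 :=
      fun i hi => dif_neg (not_lt.2 hi)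
    have hN : (if h : 0 < k + 1 then (f ⟨0, h⟩ : ℕ) else 0) ≤ N := by
      rw [dif_pos (Nat.succ_pos k)]
      exact Nat.le_of_lt_succ (f ⟨0, Nat.succ_pos k⟩).2
    have hr := rowLen_diagramOfRows (hF _ hz hne) hz hN
    refine hf ⟨diagramOfRows (k + 1) N _ (hF _ hz hne), ?_, ?_⟩
    · rw [Finset.mem_coe, mem_youngBox, hr]
      exact ⟨hz _ le_rfl, hN⟩
    · funext i
      beta_reduce
      rw [hr]
      ext
      simp only [i.2, dif_pos, Fin.ofNat_eq_cast, Fin.val_natCast]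
      exact Nat.mod_eq_of_lt (f i).2
  · intro ν hν
    conv_lhs => rw [← hext ν hν]
    simp

/-- Weight of a one-variable branching step between sequences supported on the first `k + 1`
rows. -/
def branchWeight (x : A) (k : ℕ) (lam mu : ℕ → ℕ) : A :=
  ∏ i ∈ Finset.range (k + 1), branchFactor x (lam i) (mu i) (lam (i + 1))

/-- Weight of a vertical strip between sequences supported on the first `k + 1` rows. -/
def stripWeight (s : A) (k : ℕ) (lam nu : ℕ → ℕ) : A :=
  stripStart s (lam 0) (nu 0) *
    ∏ i ∈ Finset.range k, stripFactor s (lam i) (nu i) (lam (i + 1)) (nu (i + 1))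

theorem branchWeight_ne_zero {x : A} {k : ℕ} {lam mu : ℕ → ℕ} (h : branchWeight x k lam mu ≠ 0)
    {i : ℕ} (hi : i ≤ k) : lam (i + 1) ≤ mu i ∧ mu i ≤ lam i := by
  by_contra hc
  exact h (Finset.prod_eq_zero (Finset.mem_range.2 (Nat.lt_succ_of_le hi)) (if_neg hc))

theorem stripWeight_ne_zero {s : A} {k : ℕ} {lam nu : ℕ → ℕ} (h : stripWeight s k lam nu ≠ 0)
    {i : ℕ} (hi : i ≤ k) : nu i = lam i ∨ nu i = lam i + 1 := by
  cases i with
  | zero => exact stripStart_ne_zero (left_ne_zero_of_mul h)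
  | succ i =>
    refine stripFactor_ne_zero (s := s) (p := lam i) (q := nu i) fun h0 => h ?_
    exact mul_eq_zero_of_right _ (Finset.prod_eq_zero (Finset.mem_range.2 hi) h0)

theorem antitone_of_le_succ {k : ℕ} {g : ℕ → ℕ} (hz : ∀ i, k + 1 ≤ i → g i = 0)
    (h : ∀ i < k, g (i + 1) ≤ g i) : Antitone g := by
  refine antitone_nat_of_succ_le fun i => ?_
  rcases lt_or_ge i k with hi | hi
  · exact h i hi
  · rw [hz (i + 1) (by omega)]; exact Nat.zero_le _

theorem sum_youngBox_eq_sum_transfer (k N : ℕ) (start e : ℕ → A) (step : ℕ → ℕ → ℕ → A)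
    (F : (ℕ → ℕ) → A)
    (hF : ∀ g, (∀ i, k + 1 ≤ i → g i = 0) →
      F g = start (g 0) * (∏ i ∈ Finset.range k, step i (g i) (g (i + 1))) * e (g k))
    (hanti : ∀ g, F g ≠ 0 → ∀ i < k, g (i + 1) ≤ g i) :
    ∑ ν ∈ youngBox (k + 1) N, F ν.rowLen =
      ∑ y ∈ Finset.range (N + 1), transfer (N + 1) start step k y * e y := by
  rw [← sum_fin_eq_sum_transfer, sum_youngBox k N F
    fun g hz hne => antitone_of_le_succ hz (hanti g hne)]
  refine Finset.sum_congr rfl fun f _ => ?_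
  rw [hF _ fun i hi => dif_neg (not_lt.2 hi)]
  simp only [Nat.zero_lt_succ, dif_pos, Nat.lt_succ_self]
  congr 2
  rw [← Fin.prod_univ_eq_prod_range (fun i => step i (if h : i < k + 1 then (f ⟨i, h⟩ : ℕ) else 0)
    (if h : i + 1 < k + 1 then (f ⟨i + 1, h⟩ : ℕ) else 0))]
  refine Finset.prod_congr rfl fun i _ => ?_
  rw [dif_pos (i.2.trans (Nat.lt_succ_self _)), dif_pos (Nat.succ_lt_succ i.2)]
  rfl

/-- Vertical strips commute with branching up to the factor `1 + x * s`. -/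
theorem sum_stripWeight_mul_branchWeight (x s : A) {k N : ℕ} {lam kap : YoungDiagram}
    (hlam : lam.rowLen (k + 1) = 0) (hN : lam.rowLen 0 < N) (hkap : kap.rowLen k = 0)
    (hkN : kap.rowLen 0 ≤ N) :
    ∑ ν ∈ youngBox (k + 1) N,
        stripWeight s k lam.rowLen ν.rowLen * branchWeight x k ν.rowLen kap.rowLen =
      (1 + x * s) * ∑ μ ∈ youngBox (k + 1) N,
        branchWeight x k lam.rowLen μ.rowLen * stripWeight s k μ.rowLen kap.rowLen := by
  obtain ⟨hc, -, -⟩ := transfer_invariant (n := N + 1) (x := x) (s := s) (rowLen_antitone lam)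
    (rowLen_antitone kap) (by omega) (by omega) k
  have hlk := rowLen_antitone lam (Nat.zero_le k)
  have hL := sum_youngBox_eq_sum_transfer k N (stripStart s (lam.rowLen 0))
    (fun y => branchFactor x y 0 0)
    (fun i z y => stripFactor s (lam.rowLen i) z (lam.rowLen (i + 1)) y *
      branchFactor x z (kap.rowLen i) y)
    (fun g => stripWeight s k lam.rowLen g * branchWeight x k g kap.rowLen)
    (fun g hg => by
      simp only [stripWeight, branchWeight]
      rw [Finset.prod_range_succ, hg (k + 1) le_rfl, hkap, Finset.prod_mul_distrib]
      ring)
    (fun g hg i hi => by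
      have := branchWeight_ne_zero (right_ne_zero_of_mul hg) hi.le
      omega)
  have hR := sum_youngBox_eq_sum_transfer k N (fun y => stripStart s y (kap.rowLen 0))
    (fun y => branchFactor x (lam.rowLen k) y 0)
    (fun i z y => branchFactor x (lam.rowLen i) z (lam.rowLen (i + 1)) *
      stripFactor s z (kap.rowLen i) y (kap.rowLen (i + 1)))
    (fun g => branchWeight x k lam.rowLen g * stripWeight s k g kap.rowLen)
    (fun g hg => by
      simp only [stripWeight, branchWeight]
      rw [Finset.prod_range_succ, hlam, Finset.prod_mul_distrib]
      ring)
    (fun g hg i hi => by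
      have h1 := branchWeight_ne_zero (left_ne_zero_of_mul hg) hi.le
      have h2 := branchWeight_ne_zero (left_ne_zero_of_mul hg) (Nat.succ_le_of_lt hi)
      exact h2.2.trans h1.1)
  have h1 := sum_stripBranch_mul (x := x) (s := s) (lam := lam.rowLen) (kap := kap.rowLen) (k := k)
    (n := N + 1) (by omega) (fun y => branchFactor x y 0 0)
  have h2 := sum_branchStrip_mul (x := x) (s := s) (lam := lam.rowLen) (kap := kap.rowLen) (k := k)
    (n := N + 1) (by omega) (fun y => branchFactor x (lam.rowLen k) y 0)
  have hb : ∀ y, branchFactor x y 0 0 = x ^ y := fun y => by simp [branchFactor]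
  rw [hb, hb] at h1
  rw [if_pos hkap, add_zero, hkap, hb] at h2
  rw [hkap] at hc
  calc _ = _ := hL
    _ = _ := h1
    _ = (1 + x * s) *
        (branchStrip (N + 1) x s lam.rowLen kap.rowLen k 0 * x ^ lam.rowLen k) := by
      linear_combination x ^ lam.rowLen k * hc
    _ = _ := by rw [hR]; exact congrArg _ h2.symm

end Diagrams

section StripWeight

variable {A : Type*} [CommRing A]

/-- Rows among the first `k + 1` containing a box of `nu / lam`. -/
def stripRows (k : ℕ) (lam nu : ℕ → ℕ) : Finset ℕ :=
  (Finset.range (k + 1)).filter fun i => nu i = lam i + 1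

theorem stripWeight_eq_zero (s : A) {k : ℕ} {lam nu : YoungDiagram}
    (hlam : lam.rowLen (k + 1) = 0) (hnu : nu.rowLen (k + 1) = 0)
    (h : ¬(lam ≤ nu ∧ IsVerticalStrip lam nu)) :
    stripWeight s k lam.rowLen nu.rowLen = 0 := by
  by_contra hne
  refine h ⟨le_iff_rowLen_le.2 fun i => ?_, fun i => ?_⟩
  all_goals
    rcases le_or_gt i k with hi | hi
    · rcases stripWeight_ne_zero hne hi with h | h <;> omega
    · have h1 := rowLen_antitone lam (Nat.succ_le_of_lt hi)
      have h2 := rowLen_antitone nu (Nat.succ_le_of_lt hi)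
      simp only [Nat.succ_eq_add_one] at h1 h2
      omega

theorem stripWeight_eq_pow (s : A) (k : ℕ) {lam nu : ℕ → ℕ} (hlam : Antitone lam)
    (hnu : Antitone nu) (h : ∀ i, nu i = lam i ∨ nu i = lam i + 1) :
    stripWeight s k lam nu = s ^ ((stripRows k lam nu).image lam).card *
      (1 + s) ^ ((stripRows k lam nu).card - ((stripRows k lam nu).image lam).card) := by
  have hle : ∀ t : Finset ℕ, (t.image lam).card ≤ t.card := fun t => Finset.card_image_le
  induction k with
  | zero =>
    rcases h 0 with h0 | h0 <;> simp [stripWeight, stripRows, Finset.filter_singleton,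
      stripStart, h0]
  | succ k ih =>
    have hsucc : stripWeight s (k + 1) lam nu = stripWeight s k lam nu *
        stripFactor s (lam k) (nu k) (lam (k + 1)) (nu (k + 1)) := by
      rw [stripWeight, Finset.prod_range_succ, ← mul_assoc]; rfl
    have hnot : k + 1 ∉ stripRows k lam nu := by simp [stripRows]
    rcases h (k + 1) with h1 | h1
    · have : stripRows (k + 1) lam nu = stripRows k lam nu := by
        rw [stripRows, Finset.range_add_one, Finset.filter_insert, if_neg (by omega)]; rfl
      rw [hsucc, ih, this, stripFactor, if_pos h1, mul_one]
    · have hrows : stripRows (k + 1) lam nu = insert (k + 1) (stripRows k lam nu) := by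
        rw [stripRows, Finset.range_add_one, Finset.filter_insert, if_pos (by omega)]; rfl
      have hk := hlam (Nat.le_succ k)
      have hk' := hnu (Nat.le_succ k)
      simp only [Nat.succ_eq_add_one] at hk hk'
      rw [hsucc, ih, hrows, Finset.image_insert, Finset.card_insert_of_notMem hnot, stripFactor,
        if_neg (by omega), if_pos h1]
      have hlek := hle (stripRows k lam nu)
      by_cases heq : lam k = lam (k + 1)
      · have hnk : nu k = lam k + 1 := by rcases h k with h | h <;> omega
        have hmem : lam (k + 1) ∈ (stripRows k lam nu).image lam :=
          Finset.mem_image.2 ⟨k, by simp [stripRows, hnk], heq⟩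
        rw [if_pos heq, if_pos (by omega), Finset.insert_eq_of_mem hmem, mul_assoc, ← pow_succ]
        congr 2
        omega
      · have hmem : lam (k + 1) ∉ (stripRows k lam nu).image lam := by
          intro hm
          obtain ⟨i, hi, hi'⟩ := Finset.mem_image.1 hm
          have : i ≤ k := by simp [stripRows] at hi; omega
          have := hlam this
          omega
        rw [if_neg heq, Finset.card_insert_of_notMem hmem, pow_succ, Nat.add_sub_add_right]
        ring

theorem cells_sdiff_eq_image {k : ℕ} {lam nu : YoungDiagram} (hnu : nu.rowLen (k + 1) = 0)
    (h : ∀ i, nu.rowLen i = lam.rowLen i ∨ nu.rowLen i = lam.rowLen i + 1) :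
    nu.cells \ lam.cells =
      (stripRows k lam.rowLen nu.rowLen).image fun i => (i, lam.rowLen i) := by
  ext ⟨i, j⟩
  simp only [Finset.mem_sdiff, YoungDiagram.mem_cells, YoungDiagram.mem_iff_lt_rowLen,
    stripRows, Finset.mem_image, Finset.mem_filter, Finset.mem_range, Prod.mk.injEq]
  constructor
  · rintro ⟨h1, h2⟩
    have hi : i < k + 1 := by
      by_contra! hi
      have := rowLen_antitone nu hi
      omega
    refine ⟨i, ⟨hi, ?_⟩, rfl, ?_⟩ <;> rcases h i with h | h <;> omega
  · rintro ⟨i, ⟨hi, h1⟩, rfl, rfl⟩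
    omega

theorem stripWeight_eq (s : A) {k : ℕ} {lam nu : YoungDiagram} (hnu : nu.rowLen (k + 1) = 0)
    (hle : lam ≤ nu) (hs : IsVerticalStrip lam nu) :
    stripWeight s k lam.rowLen nu.rowLen =
      s ^ ((nu.cells \ lam.cells).image Prod.snd).card *
        (1 + s) ^ (nu.card - lam.card - ((nu.cells \ lam.cells).image Prod.snd).card) := by
  have h : ∀ i, nu.rowLen i = lam.rowLen i ∨ nu.rowLen i = lam.rowLen i + 1 := fun i => by
    have h1 := le_iff_rowLen_le.1 hle i
    have h2 := hs i
    omega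
  have hcard : nu.card - lam.card = (stripRows k lam.rowLen nu.rowLen).card := by
    rw [YoungDiagram.card, YoungDiagram.card,
      ← Finset.card_sdiff_of_subset (YoungDiagram.cells_subset_iff.2 hle),
      cells_sdiff_eq_image hnu h]
    exact Finset.card_image_of_injective _ fun i j hij => congrArg Prod.fst hij
  rw [stripWeight_eq_pow s k (rowLen_antitone lam) (rowLen_antitone nu) h, hcard,
    cells_sdiff_eq_image hnu h, Finset.image_image]
  rfl

end StripWeight

section Branching

theorem SVT.eq_of_entry_eq {cells : Finset (ℕ × ℕ)} {T U : SVT cells}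
    (h : ∀ c ∈ cells, T.entry c = U.entry c) : T = U := by
  have : T.entry = U.entry := by
    funext c
    by_cases hc : c ∈ cells
    · exact h c hc
    · rw [T.eq_empty_of_not_mem c hc, U.eq_empty_of_not_mem c hc]
  cases T
  cases U
  simp_all

/-- Set-valued tableaux with entries below `m`. -/
abbrev BoundedSVT (cells : Finset (ℕ × ℕ)) (m : ℕ) : Type := {T : SVT cells // T.Bounded m}

instance (cells : Finset (ℕ × ℕ)) (m : ℕ) : Finite (BoundedSVT cells m) := by
  refine Finite.of_injective (β := cells → (Finset.range m).powerset)
    (fun T c => ⟨T.1.entry c, Finset.mem_powerset.2 fun x hx => Finset.mem_range.2 (T.2 c x hx)⟩) ?_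
  intro T U h
  refine Subtype.ext (SVT.eq_of_entry_eq fun c hc => ?_)
  exact congrArg Subtype.val (congrFun h ⟨c, hc⟩)

noncomputable instance (cells : Finset (ℕ × ℕ)) (m : ℕ) : Fintype (BoundedSVT cells m) :=
  Fintype.ofFinite _

/-- Signed weight of a box filled with `S`. -/
noncomputable def boxWeight (S : Finset ℕ) : MvPolynomial ℕ ℤ := -∏ i ∈ S, -X i

theorem boxWeight_eq {S : Finset ℕ} (hS : S.Nonempty) :
    boxWeight S = (-1) ^ (S.card - 1) * ∏ i ∈ S, X i := by
  obtain ⟨n, hn⟩ : ∃ n, S.card = n + 1 := ⟨S.card - 1, by have := hS.card_pos; omega⟩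
  rw [boxWeight, Finset.prod_neg, hn, Nat.add_sub_cancel, pow_succ]
  ring

theorem boxWeight_singleton (i : ℕ) : boxWeight {i} = X i := by simp [boxWeight]

theorem boxWeight_union_singleton {S : Finset ℕ} {i : ℕ} (hi : i ∉ S) :
    boxWeight (S ∪ {i}) = boxWeight S * -X i := by
  rw [Finset.union_comm, ← Finset.insert_eq, boxWeight, Finset.prod_insert hi, boxWeight]
  ring

theorem grothendieck_eq_sum (cells : Finset (ℕ × ℕ)) (m : ℕ) :
    grothendieck cells m = ∑ T : BoundedSVT cells m, ∏ c ∈ cells, boxWeight (T.1.entry c) := by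
  rw [grothendieck, ← finsum_subtype_eq_finsum_cond, finsum_eq_sum_of_fintype]
  refine Finset.sum_congr rfl fun T _ => ?_
  rw [Finset.prod_congr rfl fun c hc => boxWeight_eq (T.1.nonempty_of_mem c hc),
    Finset.prod_mul_distrib, Finset.prod_pow_eq_pow_sum,
    Finset.sum_tsub_distrib _ fun c hc => (T.1.nonempty_of_mem c hc).card_pos]
  simp [SVT.size, SVT.monomial, zsmul_eq_mul]

theorem SVT.le_of_mem_entry {μ : YoungDiagram} (T : SVT μ.cells) {i j x : ℕ}
    (hx : x ∈ T.entry (i, j)) : i ≤ x := by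
  have hc : ∀ {c y}, y ∈ T.entry c → c ∈ μ.cells := by
    intro c y hy
    by_contra h
    simp [T.eq_empty_of_not_mem c h] at hy
  induction i generalizing x with
  | zero => exact Nat.zero_le _
  | succ i ih =>
    have h1 := hc hx
    have h0 : (i, j) ∈ μ.cells := μ.up_left_mem (Nat.le_succ i) le_rfl h1
    obtain ⟨y, hy⟩ := T.nonempty_of_mem _ h0
    exact (ih hy).trans_lt (T.col_strict i j h0 h1 y hy x hx)

theorem grothendieck_eq_zero {μ : YoungDiagram} {m : ℕ} (h : μ.rowLen m ≠ 0) :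
    grothendieck μ.cells m = 0 := by
  rw [grothendieck_eq_sum]
  refine Finset.sum_eq_zero fun T _ => ?_
  have hc : (m, 0) ∈ μ.cells := YoungDiagram.mem_iff_lt_rowLen.2 (Nat.pos_of_ne_zero h)
  obtain ⟨x, hx⟩ := T.1.nonempty_of_mem _ hc
  exact absurd (T.2 _ x hx) (not_lt.2 (T.1.le_of_mem_entry hx))

theorem grothendieck_bot (m : ℕ) : grothendieck (⊥ : YoungDiagram).cells m = 1 := by
  rw [grothendieck_eq_sum, YoungDiagram.cells_bot]
  have : Unique (BoundedSVT ∅ m) :=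
    { default := ⟨⟨fun _ => ∅, by simp, by simp, by simp, by simp⟩, by simp [SVT.Bounded]⟩
      uniq := fun T => Subtype.ext (SVT.eq_of_entry_eq (by simp)) }
  simp

variable {lam mu : YoungDiagram} {m : ℕ}

/-- `μ` interlaces `λ`: the skew diagram `λ / μ` is a horizontal strip. -/
def Interlaces (lam mu : YoungDiagram) : Prop :=
  ∀ i, lam.rowLen (i + 1) ≤ mu.rowLen i ∧ mu.rowLen i ≤ lam.rowLen i

/-- The rows of `μ`, among the first `k + 1`, whose last box has no box of `λ` below it. -/
def freeRows (k : ℕ) (lam mu : YoungDiagram) : Finset ℕ :=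
  (Finset.range (k + 1)).filter fun i => lam.rowLen (i + 1) < mu.rowLen i

/-- The boxes of `λ` receiving the new largest entry, given the set `D` of rows of `μ` whose last
box receives it. -/
def NewBox (lam mu : YoungDiagram) (D : Finset ℕ) (c : ℕ × ℕ) : Prop :=
  (c ∈ lam.cells ∧ c ∉ mu.cells) ∨ (c.1 ∈ D ∧ c.2 + 1 = mu.rowLen c.1)

open Classical in
/-- Extend a tableau of shape `μ` by a new largest entry `m`. -/
noncomputable def extendSVT (h : Interlaces lam mu) {k : ℕ} (T : BoundedSVT mu.cells m)
    {D : Finset ℕ} (hD : D ⊆ freeRows k lam mu) : BoundedSVT lam.cells (m + 1) := by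
  have hfree : ∀ i ∈ D, lam.rowLen (i + 1) < mu.rowLen i := fun i hi =>
    (Finset.mem_filter.1 (hD hi)).2
  have hT : ∀ {c a}, a ∈ T.1.entry c → c ∈ mu.cells := by
    intro c a ha
    by_contra hc
    simp [T.1.eq_empty_of_not_mem c hc] at ha
  have hmem : ∀ {c a}, a ∈ T.1.entry c ∪ (if NewBox lam mu D c then {m} else ∅) ↔
      a ∈ T.1.entry c ∨ (NewBox lam mu D c ∧ a = m) := by
    intro c a
    split_ifs with hc <;> simp [hc, or_comm]
  have hsub : mu.cells ⊆ lam.cells :=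
    YoungDiagram.cells_subset_iff.2 (le_iff_rowLen_le.2 fun i => (h i).2)
  exact
  ⟨{ entry := fun c => T.1.entry c ∪ (if NewBox lam mu D c then {m} else ∅)
     nonempty_of_mem := by
      intro c hc
      by_cases hc' : c ∈ mu.cells
      · exact (T.1.nonempty_of_mem c hc').mono Finset.subset_union_left
      · exact ⟨m, hmem.2 (Or.inr ⟨Or.inl ⟨hc, hc'⟩, rfl⟩)⟩
     eq_empty_of_not_mem := by
      rintro ⟨i, j⟩ hc
      rw [T.1.eq_empty_of_not_mem _ fun h => hc (hsub h), if_neg, Finset.union_empty]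
      rintro (⟨h1, -⟩ | ⟨-, h2⟩)
      · exact hc h1
      · refine hc (hsub (YoungDiagram.mem_iff_lt_rowLen.2 ?_))
        simp only at h2
        omega
     row_weak := by
      intro i j h1 h2 a ha b hb
      rw [hmem] at ha hb
      have ham : a ≤ m := ha.elim (fun ha => (T.2 _ a ha).le) (fun ha => ha.2.le)
      rcases hb with hb | ⟨-, rfl⟩
      · have h2' := hT hb
        have h1' : (i, j) ∈ mu.cells := mu.up_left_mem le_rfl (Nat.le_succ j) h2'
        rcases ha with ha | ⟨(⟨-, h3⟩ | ⟨-, h3⟩), rfl⟩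
        · exact T.1.row_weak i j h1' h2' a ha b hb
        · exact absurd h1' h3
        · have := YoungDiagram.mem_iff_lt_rowLen.1 h2'
          simp only at h3
          omega
      · exact ham
     col_strict := by
      intro i j h1 h2 a ha b hb
      rw [hmem] at ha hb
      have h2' := YoungDiagram.mem_iff_lt_rowLen.1 h2
      have h1' : (i, j) ∈ mu.cells :=
        YoungDiagram.mem_iff_lt_rowLen.2 (h2'.trans_le (h i).1)
      rcases ha with ha | ⟨(⟨-, h3⟩ | ⟨h4, h3⟩), rfl⟩
      · rcases hb with hb | ⟨-, rfl⟩
        · exact T.1.col_strict i j h1' (hT hb) a ha b hb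
        · exact T.2 _ a ha
      · exact absurd h1' h3
      · have := hfree i h4
        simp only at h3
        omega },
   by
    intro c a ha
    rcases hmem.1 ha with ha | ⟨-, rfl⟩
    · exact (T.2 _ a ha).trans (Nat.lt_succ_self m)
    · exact Nat.lt_succ_self _⟩

open Classical in
theorem entry_extendSVT (h : Interlaces lam mu) {k : ℕ} (T : BoundedSVT mu.cells m)
    {D : Finset ℕ} (hD : D ⊆ freeRows k lam mu) (c : ℕ × ℕ) :
    (extendSVT h T hD).1.entry c = T.1.entry c ∪ (if NewBox lam mu D c then {m} else ∅) := rfl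

/-- The shape formed by the boxes of a tableau having an entry below `m`. -/
def smallShape (m : ℕ) (T : SVT lam.cells) : YoungDiagram where
  cells := lam.cells.filter fun c => ((T.entry c).filter (· < m)).Nonempty
  isLowerSet := by
    have key : ∀ c, c ∈ lam.cells.filter (fun c => ((T.entry c).filter (· < m)).Nonempty) ↔
        c ∈ lam.cells ∧ ∃ a ∈ T.entry c, a < m := by
      intro c
      simp [Finset.Nonempty]
    have hrow : ∀ i j, ((i, j + 1) ∈ lam.cells ∧ ∃ a ∈ T.entry (i, j + 1), a < m) →
        ((i, j) ∈ lam.cells ∧ ∃ a ∈ T.entry (i, j), a < m) := by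
      rintro i j ⟨h1, b, hb, hbm⟩
      have h0 : (i, j) ∈ lam.cells := lam.up_left_mem le_rfl (Nat.le_succ j) h1
      obtain ⟨a, ha⟩ := T.nonempty_of_mem _ h0
      exact ⟨h0, a, ha, (T.row_weak i j h0 h1 a ha b hb).trans_lt hbm⟩
    have hcol : ∀ i j, ((i + 1, j) ∈ lam.cells ∧ ∃ a ∈ T.entry (i + 1, j), a < m) →
        ((i, j) ∈ lam.cells ∧ ∃ a ∈ T.entry (i, j), a < m) := by
      rintro i j ⟨h1, b, hb, hbm⟩
      have h0 : (i, j) ∈ lam.cells := lam.up_left_mem (Nat.le_succ i) le_rfl h1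
      obtain ⟨a, ha⟩ := T.nonempty_of_mem _ h0
      exact ⟨h0, a, ha, (T.col_strict i j h0 h1 a ha b hb).trans hbm⟩
    rintro ⟨i, j⟩ ⟨i', j'⟩ ⟨hi, hj⟩ hc
    rw [Finset.mem_coe, key] at hc ⊢
    simp only at hi hj
    obtain ⟨d, rfl⟩ := Nat.exists_eq_add_of_le hi
    obtain ⟨e, rfl⟩ := Nat.exists_eq_add_of_le hj
    clear hi hj
    induction d with
    | zero =>
      induction e with
      | zero => exact hc
      | succ e ih => exact ih (hrow _ _ hc)
    | succ d ih => exact ih (hcol _ _ hc)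

theorem mem_smallShape {T : SVT lam.cells} {c : ℕ × ℕ} :
    c ∈ (smallShape m T).cells ↔ c ∈ lam.cells ∧ ∃ a ∈ T.entry c, a < m := by
  simp [smallShape, Finset.Nonempty]

theorem smallShape_interlaces (T : BoundedSVT lam.cells (m + 1)) :
    Interlaces lam (smallShape m T.1) := by
  intro i
  constructor
  · by_contra! hlt
    set j := (smallShape m T.1).rowLen i
    have h1 : (i + 1, j) ∈ lam.cells := YoungDiagram.mem_iff_lt_rowLen.2 hlt
    have h0 : (i, j) ∈ lam.cells := lam.up_left_mem (Nat.le_succ i) le_rfl h1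
    obtain ⟨a, ha⟩ := T.1.nonempty_of_mem _ h0
    obtain ⟨b, hb⟩ := T.1.nonempty_of_mem _ h1
    have hab := T.1.col_strict i j h0 h1 a ha b hb
    have hbm := T.2 _ b hb
    have : (i, j) ∈ (smallShape m T.1).cells := mem_smallShape.2 ⟨h0, a, ha, by omega⟩
    exact lt_irrefl _ (YoungDiagram.mem_iff_lt_rowLen.1 this)
  · refine le_iff_rowLen_le.1 (YoungDiagram.cells_subset_iff.1 fun c hc => ?_) i
    exact (mem_smallShape.1 hc).1

/-- Restrict a tableau to its entries below `m`. -/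
def restrictSVT (T : SVT lam.cells) (h : smallShape m T = mu) : BoundedSVT mu.cells m :=
  ⟨{ entry := fun c => (T.entry c).filter (· < m)
     nonempty_of_mem := by
      intro c hc
      subst h
      obtain ⟨-, a, ha, ham⟩ := mem_smallShape.1 hc
      exact ⟨a, Finset.mem_filter.2 ⟨ha, ham⟩⟩
     eq_empty_of_not_mem := by
      intro c hc
      subst h
      by_contra hne
      obtain ⟨a, ha⟩ := Finset.nonempty_iff_ne_empty.2 hne
      rw [Finset.mem_filter] at ha
      refine hc (mem_smallShape.2 ⟨?_, a, ha⟩)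
      by_contra hl
      simp [T.eq_empty_of_not_mem c hl] at ha
     row_weak := by
      intro i j h1 h2 a ha b hb
      subst h
      exact T.row_weak i j (mem_smallShape.1 h1).1 (mem_smallShape.1 h2).1 a
        (Finset.mem_filter.1 ha).1 b (Finset.mem_filter.1 hb).1
     col_strict := by
      intro i j h1 h2 a ha b hb
      subst h
      exact T.col_strict i j (mem_smallShape.1 h1).1 (mem_smallShape.1 h2).1 a
        (Finset.mem_filter.1 ha).1 b (Finset.mem_filter.1 hb).1 },
   fun _ _ ha => (Finset.mem_filter.1 ha).2⟩


theorem SVT.mem_cells_of_mem_entry {cells : Finset (ℕ × ℕ)} (T : SVT cells) {c : ℕ × ℕ} {a : ℕ}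
    (ha : a ∈ T.entry c) : c ∈ cells := by
  by_contra hc
  simp [T.eq_empty_of_not_mem c hc] at ha

theorem Interlaces.cells_subset (h : Interlaces lam mu) : mu.cells ⊆ lam.cells :=
  YoungDiagram.cells_subset_iff.2 (le_iff_rowLen_le.2 fun i => (h i).2)

/-- The free rows of `μ` whose last box contains `m`. -/
def markedRows (k m : ℕ) (mu : YoungDiagram) (T : SVT lam.cells) : Finset ℕ :=
  (freeRows k lam mu).filter fun i => m ∈ T.entry (i, mu.rowLen i - 1)

theorem newBox_markedRows_iff {k : ℕ} (hlam : lam.rowLen (k + 1) = 0)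
    (T : BoundedSVT lam.cells (m + 1)) (h : smallShape m T.1 = mu) (c : ℕ × ℕ) :
    NewBox lam mu (markedRows k m mu T.1) c ↔ m ∈ T.1.entry c := by
  obtain ⟨i, j⟩ := c
  constructor
  · rintro (⟨hc, hc'⟩ | ⟨hi, hj⟩)
    · obtain ⟨a, ha⟩ := T.1.nonempty_of_mem _ hc
      have ham := T.2 _ a ha
      have : ¬ a < m := fun hlt => hc' (h ▸ mem_smallShape.2 ⟨hc, a, ha, hlt⟩)
      obtain rfl : a = m := by omega
      exact ha
    · have := (Finset.mem_filter.1 hi).2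
      simp only at hj this
      rwa [← hj, Nat.add_sub_cancel] at this
  · intro hm
    have hc := T.1.mem_cells_of_mem_entry hm
    by_cases hc' : (i, j) ∈ mu.cells
    · have hj := YoungDiagram.mem_iff_lt_rowLen.1 hc'
      have hj' : j + 1 = mu.rowLen i := by
        by_contra hne
        have h1 : (i, j + 1) ∈ mu.cells := YoungDiagram.mem_iff_lt_rowLen.2 (by omega)
        rw [← h] at h1
        obtain ⟨h2, a, ha, ham⟩ := mem_smallShape.1 h1
        exact absurd (T.1.row_weak i j hc h2 m hm a ha) (not_le.2 ham)
      have hfree : lam.rowLen (i + 1) < mu.rowLen i := by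
        by_contra! hle
        have h2 : (i + 1, j) ∈ lam.cells := YoungDiagram.mem_iff_lt_rowLen.2 (by omega)
        obtain ⟨a, ha⟩ := T.1.nonempty_of_mem _ h2
        have h3 := T.1.col_strict i j hc h2 m hm a ha
        have h4 := T.2 _ a ha
        omega
      have hi : i < k + 1 := by
        by_contra! hle
        have h1 := rowLen_antitone lam hle
        have h2 : j < lam.rowLen i := YoungDiagram.mem_iff_lt_rowLen.1 hc
        omega
      refine Or.inr ⟨Finset.mem_filter.2 ⟨Finset.mem_filter.2 ⟨Finset.mem_range.2 hi, hfree⟩, ?_⟩,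
        hj'⟩
      simpa [← hj'] using hm
    · exact Or.inl ⟨hc, hc'⟩

theorem extendSVT_restrictSVT {k : ℕ} (hlam : lam.rowLen (k + 1) = 0)
    (T : BoundedSVT lam.cells (m + 1)) (h : smallShape m T.1 = mu) (hi : Interlaces lam mu) :
    extendSVT hi (restrictSVT T.1 h) (Finset.filter_subset _ _ : markedRows k m mu T.1 ⊆ _) = T := by
  refine Subtype.ext (SVT.eq_of_entry_eq fun c _ => ?_)
  rw [entry_extendSVT]
  ext a
  have hr : (restrictSVT T.1 h).1.entry c = (T.1.entry c).filter (· < m) := rfl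
  rw [hr]
  have hT := T.2 c a
  have hnew := newBox_markedRows_iff hlam T h c
  split_ifs with hm
  · replace hm := hnew.1 hm
    simp only [Finset.mem_union, Finset.mem_filter, Finset.mem_singleton]
    constructor
    · rintro (h | rfl)
      exacts [h.1, hm]
    · intro ha
      have := hT ha
      rcases Nat.lt_succ_iff_lt_or_eq.1 this with h | h
      exacts [Or.inl ⟨ha, h⟩, Or.inr h]
  · replace hm := mt hnew.2 hm
    simp only [Finset.union_empty, Finset.mem_filter, and_iff_left_iff_imp]
    intro ha
    rcases Nat.lt_succ_iff_lt_or_eq.1 (hT ha) with h | rfl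
    exacts [h, absurd ha hm]

theorem smallShape_extendSVT (h : Interlaces lam mu) {k : ℕ} (T : BoundedSVT mu.cells m)
    {D : Finset ℕ} (hD : D ⊆ freeRows k lam mu) :
    smallShape m (extendSVT h T hD).1 = mu := by
  ext c
  rw [mem_smallShape, entry_extendSVT]
  constructor
  · rintro ⟨-, a, ha, ham⟩
    rcases Finset.mem_union.1 ha with ha | ha
    · exact T.1.mem_cells_of_mem_entry ha
    · split_ifs at ha
      · exact absurd (Finset.mem_singleton.1 ha) ham.ne
      · simp at ha
  · intro hc
    obtain ⟨a, ha⟩ := T.1.nonempty_of_mem c hc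
    exact ⟨h.cells_subset hc, a, Finset.mem_union_left _ ha, T.2 _ a ha⟩

theorem restrictSVT_extendSVT (h : Interlaces lam mu) {k : ℕ} (T : BoundedSVT mu.cells m)
    {D : Finset ℕ} (hD : D ⊆ freeRows k lam mu) :
    restrictSVT (extendSVT h T hD).1 (smallShape_extendSVT h T hD) = T := by
  refine Subtype.ext (SVT.eq_of_entry_eq fun c _ => ?_)
  change ((extendSVT h T hD).1.entry c).filter (· < m) = _
  rw [entry_extendSVT, Finset.filter_union, Finset.filter_true_of_mem (T.2 c)]
  split_ifs <;> simp [Finset.filter_singleton]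

theorem markedRows_extendSVT (h : Interlaces lam mu) {k : ℕ} (T : BoundedSVT mu.cells m)
    {D : Finset ℕ} (hD : D ⊆ freeRows k lam mu) :
    markedRows k m mu (extendSVT h T hD).1 = D := by
  ext i
  rw [markedRows, Finset.mem_filter, entry_extendSVT, Finset.mem_union]
  have hm : m ∉ T.1.entry (i, mu.rowLen i - 1) := fun hm => lt_irrefl _ (T.2 _ _ hm)
  constructor
  · rintro ⟨hi, hi' | hi'⟩
    · exact absurd hi' hm
    · have hpos : lam.rowLen (i + 1) < mu.rowLen i := (Finset.mem_filter.1 hi).2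
      split_ifs at hi' with hnew
      · rcases hnew with ⟨-, hc⟩ | ⟨hiD, -⟩
        · exact absurd (YoungDiagram.mem_iff_lt_rowLen.2 (by omega)) hc
        · exact hiD
      · simp at hi'
  · intro hi
    have hpos : lam.rowLen (i + 1) < mu.rowLen i := (Finset.mem_filter.1 (hD hi)).2
    refine ⟨hD hi, Or.inr ?_⟩
    have hnew : NewBox lam mu D (i, mu.rowLen i - 1) :=
      Or.inr ⟨hi, Nat.succ_pred_eq_of_pos (Nat.zero_lt_of_lt hpos)⟩
    rw [if_pos hnew]
    exact Finset.mem_singleton_self m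

theorem prod_boxWeight_extendSVT (h : Interlaces lam mu) {k : ℕ} (T : BoundedSVT mu.cells m)
    {D : Finset ℕ} (hD : D ⊆ freeRows k lam mu) :
    ∏ c ∈ lam.cells, boxWeight ((extendSVT h T hD).1.entry c) =
      (X m ^ (lam.cells \ mu.cells).card * (-X m) ^ D.card) *
        ∏ c ∈ mu.cells, boxWeight (T.1.entry c) := by
  have hsdiff : ∀ c ∈ lam.cells \ mu.cells, boxWeight ((extendSVT h T hD).1.entry c) = X m := by
    intro c hc
    obtain ⟨h1, h2⟩ := Finset.mem_sdiff.1 hc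
    have hnew : NewBox lam mu D c := Or.inl ⟨h1, h2⟩
    rw [entry_extendSVT, T.1.eq_empty_of_not_mem c h2, if_pos hnew,
      Finset.empty_union, boxWeight_singleton]
  have hmu : ∀ c ∈ mu.cells, boxWeight ((extendSVT h T hD).1.entry c) =
      boxWeight (T.1.entry c) * if c.1 ∈ D ∧ c.2 + 1 = mu.rowLen c.1 then -X m else 1 := by
    intro c hc
    have hnew : NewBox lam mu D c ↔ c.1 ∈ D ∧ c.2 + 1 = mu.rowLen c.1 := by
      simp [NewBox, show c ∈ mu by exact hc]
    rw [entry_extendSVT]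
    simp only [hnew]
    split_ifs
    · exact boxWeight_union_singleton fun hm => lt_irrefl _ (T.2 _ _ hm)
    · rw [Finset.union_empty, mul_one]
  have hcard : (mu.cells.filter fun c => c.1 ∈ D ∧ c.2 + 1 = mu.rowLen c.1).card = D.card := by
    refine Finset.card_bij (fun c _ => c.1) (fun c hc => (Finset.mem_filter.1 hc).2.1) ?_ ?_
    · rintro ⟨i, j⟩ hc ⟨i', j'⟩ hc' (rfl : i = i')
      have h1 := (Finset.mem_filter.1 hc).2.2
      have h2 := (Finset.mem_filter.1 hc').2.2
      simp only at h1 h2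
      simp only [Prod.mk.injEq, true_and]
      omega
    · intro i hi
      have hpos : lam.rowLen (i + 1) < mu.rowLen i := (Finset.mem_filter.1 (hD hi)).2
      refine ⟨(i, mu.rowLen i - 1), Finset.mem_filter.2 ⟨?_, hi, ?_⟩, rfl⟩
      · exact YoungDiagram.mem_iff_lt_rowLen.2 (by omega)
      · simp only
        omega
  rw [← Finset.prod_sdiff h.cells_subset, Finset.prod_congr rfl hsdiff, Finset.prod_congr rfl hmu,
    Finset.prod_mul_distrib, Finset.prod_ite, Finset.prod_const, Finset.prod_const, hcard]
  simp only [Finset.prod_const_one]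
  ring

theorem card_cells_sdiff {k : ℕ} (hlam : lam.rowLen (k + 1) = 0) :
    (lam.cells \ mu.cells).card = ∑ i ∈ Finset.range (k + 1), (lam.rowLen i - mu.rowLen i) := by
  rw [Finset.card_eq_sum_card_fiberwise (f := Prod.fst) (t := Finset.range (k + 1))]
  · refine Finset.sum_congr rfl fun i _ => ?_
    rw [← Nat.card_Ico]
    refine Finset.card_bij (fun c _ => c.2) ?_ ?_ ?_
    · rintro ⟨i', j⟩ hc
      simp only [Finset.mem_filter, Finset.mem_sdiff, YoungDiagram.mem_cells,
        YoungDiagram.mem_iff_lt_rowLen] at hc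
      obtain ⟨⟨h1, h2⟩, rfl⟩ := hc
      exact Finset.mem_Ico.2 ⟨not_lt.1 h2, h1⟩
    · rintro ⟨i₁, j₁⟩ h₁ ⟨i₂, j₂⟩ h₂ h
      have e₁ := (Finset.mem_filter.1 h₁).2
      have e₂ := (Finset.mem_filter.1 h₂).2
      simp only at e₁ e₂ h
      rw [e₁, e₂, h]
    · intro j hj
      rw [Finset.mem_Ico] at hj
      refine ⟨(i, j), ?_, rfl⟩
      simp only [Finset.mem_filter, Finset.mem_sdiff, YoungDiagram.mem_cells,
        YoungDiagram.mem_iff_lt_rowLen, and_true]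
      omega
  · rintro ⟨i, j⟩ hc
    have h1 : j < lam.rowLen i := YoungDiagram.mem_iff_lt_rowLen.1 (Finset.mem_sdiff.1 hc).1
    simp only [Finset.coe_range, Set.mem_Iio]
    by_contra! hi
    have := rowLen_antitone lam hi
    omega

theorem branchWeight_eq {A : Type*} [CommRing A] (x : A) {k : ℕ} (hlam : lam.rowLen (k + 1) = 0)
    (h : Interlaces lam mu) : branchWeight x k lam.rowLen mu.rowLen =
      x ^ (lam.cells \ mu.cells).card * (1 - x) ^ (freeRows k lam mu).card := by
  rw [branchWeight, card_cells_sdiff hlam, ← Finset.prod_pow_eq_pow_sum, freeRows,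
    ← Finset.prod_const, Finset.prod_filter, ← Finset.prod_mul_distrib]
  exact Finset.prod_congr rfl fun i _ => if_pos (h i)

open Classical in
theorem sum_smallShape_eq {k : ℕ} (hlam : lam.rowLen (k + 1) = 0) (h : Interlaces lam mu) :
    ∑ T : BoundedSVT lam.cells (m + 1) with smallShape m T.1 = mu,
        ∏ c ∈ lam.cells, boxWeight (T.1.entry c) =
      branchWeight (X m) k lam.rowLen mu.rowLen * grothendieck mu.cells m := by
  have hsum : (1 - X m : MvPolynomial ℕ ℤ) ^ (freeRows k lam mu).card =
      ∑ D ∈ (freeRows k lam mu).powerset, (-X m) ^ D.card := by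
    have := Finset.sum_pow_mul_eq_add_pow (-X m : MvPolynomial ℕ ℤ) 1 (freeRows k lam mu)
    simp only [one_pow, mul_one] at this
    rw [this]
    ring
  rw [branchWeight_eq _ hlam h, hsum, grothendieck_eq_sum, Finset.mul_sum _ _ (X m ^ _),
    Finset.sum_mul_sum,
    ← Finset.sum_product']
  refine (Finset.sum_bij' (fun p hp => extendSVT h p.2
      (Finset.mem_powerset.1 (Finset.mem_product.1 hp).1))
    (fun T hT => (markedRows k m mu T.1, restrictSVT T.1 (Finset.mem_filter.1 hT).2))
    ?_ ?_ ?_ ?_ ?_).symm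
  · exact fun p hp => Finset.mem_filter.2 ⟨Finset.mem_univ _, smallShape_extendSVT h _ _⟩
  · exact fun T hT => Finset.mem_product.2
      ⟨Finset.mem_powerset.2 (Finset.filter_subset _ _), Finset.mem_univ _⟩
  · exact fun p hp => Prod.ext (markedRows_extendSVT h _ _) (restrictSVT_extendSVT h _ _)
  · exact fun T hT => extendSVT_restrictSVT hlam T (Finset.mem_filter.1 hT).2 h
  · exact fun p hp => (prod_boxWeight_extendSVT h _ _).symm

/-- Branching rule: splitting off the last variable. -/
theorem grothendieck_succ {k N : ℕ} (hlam : lam ∈ youngBox (k + 1) N) :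
    grothendieck lam.cells (m + 1) = ∑ μ ∈ youngBox (k + 1) N,
      branchWeight (X m) k lam.rowLen μ.rowLen * grothendieck μ.cells m := by
  classical
  obtain ⟨hk, hN⟩ := mem_youngBox.1 hlam
  rw [grothendieck_eq_sum, ← Finset.sum_fiberwise_of_maps_to (t := youngBox (k + 1) N)
    (g := fun T : BoundedSVT lam.cells (m + 1) => smallShape m T.1)]
  · refine Finset.sum_congr rfl fun μ hμ => ?_
    by_cases h : Interlaces lam μ
    · exact sum_smallShape_eq hk h
    · rw [Finset.sum_eq_zero fun T hT => absurd (smallShape_interlaces T)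
        ((Finset.mem_filter.1 hT).2 ▸ h)]
      by_contra hne
      refine h fun i => ?_
      rcases le_or_gt i k with hi | hi
      · exact branchWeight_ne_zero (left_ne_zero_of_mul (Ne.symm hne)) hi
      · have h1 := rowLen_antitone lam (show k + 1 ≤ i + 1 by omega)
        have h2 := rowLen_antitone μ (show k + 1 ≤ i by omega)
        have h3 := (mem_youngBox.1 hμ).1
        omega
  · intro T _
    have h := fun i => (smallShape_interlaces T i).2
    exact mem_youngBox.2 ⟨Nat.le_zero.1 (hk ▸ h _), (h 0).trans hN⟩

end Branching

section Pieri

open scoped Polynomial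

theorem map_branchWeight {A B : Type*} [CommRing A] [CommRing B] (φ : A →+* B) (x : A) (k : ℕ)
    (lam mu : ℕ → ℕ) : φ (branchWeight x k lam mu) = branchWeight (φ x) k lam mu := by
  simp [branchWeight, branchFactor, apply_ite φ]

theorem rowLen_bot (i : ℕ) : (⊥ : YoungDiagram).rowLen i = 0 := by
  by_contra h
  exact YoungDiagram.notMem_bot (i, 0) (YoungDiagram.mem_iff_lt_rowLen.2 (Nat.pos_of_ne_zero h))

theorem eq_bot_of_rowLen_zero {μ : YoungDiagram} (h : μ.rowLen 0 = 0) : μ = ⊥ := by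
  refine rowLen_injective (funext fun i => ?_)
  have := rowLen_antitone μ (Nat.zero_le i)
  rw [rowLen_bot]
  omega

theorem prod_mul_grothendieck (s : (MvPolynomial ℕ ℤ)[X]) {k N m : ℕ} (hm : m ≤ k + 1)
    {lam : YoungDiagram} (hlam : lam.rowLen (k + 1) = 0) (hN : lam.rowLen 0 < N) :
    (∏ i ∈ Finset.range m, (1 + Polynomial.C (MvPolynomial.X i) * s)) * Polynomial.C (grothendieck lam.cells m) =
      ∑ ν ∈ youngBox (k + 1) N,
        stripWeight s k lam.rowLen ν.rowLen * Polynomial.C (grothendieck ν.cells m) := by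
  induction m generalizing lam with
  | zero =>
    have hbot : (⊥ : YoungDiagram) ∈ youngBox (k + 1) N :=
      mem_youngBox.2 ⟨rowLen_bot _, by rw [rowLen_bot]; omega⟩
    rw [Finset.range_zero, Finset.prod_empty, one_mul, Finset.sum_eq_single_of_mem _ hbot]
    · by_cases h : lam = ⊥
      · subst h
        rw [stripWeight_eq s (rowLen_bot _) le_rfl fun i => Nat.le_succ _]
        simp
      · rw [grothendieck_eq_zero fun h0 => h (eq_bot_of_rowLen_zero h0),
          stripWeight_eq_zero s hlam (rowLen_bot _) fun h' => h (le_bot_iff.1 h'.1), map_zero,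
          zero_mul]
    · intro ν _ hν
      rw [grothendieck_eq_zero fun h0 => hν (eq_bot_of_rowLen_zero h0), map_zero, mul_zero]
  | succ m ih =>
    set B := youngBox (k + 1) N
    set x : (MvPolynomial ℕ ℤ)[X] := Polynomial.C (MvPolynomial.X m)
    have hsplit : ∀ ν ∈ B, Polynomial.C (grothendieck ν.cells (m + 1)) =
        ∑ κ ∈ B, branchWeight x k ν.rowLen κ.rowLen * Polynomial.C (grothendieck κ.cells m) := by
      intro ν hν
      simp [grothendieck_succ hν, map_branchWeight, x, B]
    have hcomm : ∀ κ ∈ B, (∑ ν ∈ B, stripWeight s k lam.rowLen ν.rowLen *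
          branchWeight x k ν.rowLen κ.rowLen) * Polynomial.C (grothendieck κ.cells m) =
        ((1 + x * s) * ∑ μ ∈ B, branchWeight x k lam.rowLen μ.rowLen *
          stripWeight s k μ.rowLen κ.rowLen) * Polynomial.C (grothendieck κ.cells m) := by
      intro κ hκ
      by_cases hk : κ.rowLen k = 0
      · rw [sum_stripWeight_mul_branchWeight x s hlam hN hk (mem_youngBox.1 hκ).2]
      · have := rowLen_antitone κ (show m ≤ k by omega)
        rw [grothendieck_eq_zero (show κ.rowLen m ≠ 0 by omega), map_zero, mul_zero, mul_zero]
    have hih : ∀ μ ∈ B, branchWeight x k lam.rowLen μ.rowLen *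
          ((∏ i ∈ Finset.range m, (1 + Polynomial.C (MvPolynomial.X i) * s)) * Polynomial.C (grothendieck μ.cells m)) =
        branchWeight x k lam.rowLen μ.rowLen *
          ∑ κ ∈ B, stripWeight s k μ.rowLen κ.rowLen * Polynomial.C (grothendieck κ.cells m) := by
      intro μ hμ
      by_cases hb : branchWeight x k lam.rowLen μ.rowLen = 0
      · rw [hb, zero_mul, zero_mul]
      · rw [ih (by omega) (mem_youngBox.1 hμ).1
          ((branchWeight_ne_zero hb (Nat.zero_le k)).2.trans_lt hN)]
    calc _ = (1 + x * s) * ∑ μ ∈ B, branchWeight x k lam.rowLen μ.rowLen *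
          ((∏ i ∈ Finset.range m, (1 + Polynomial.C (MvPolynomial.X i) * s)) *
            Polynomial.C (grothendieck μ.cells m)) := by
          rw [hsplit lam (mem_youngBox.2 ⟨hlam, hN.le⟩), Finset.prod_range_succ, Finset.mul_sum,
            Finset.mul_sum]
          exact Finset.sum_congr rfl fun μ _ => by ring
      _ = ∑ κ ∈ B, ((1 + x * s) * ∑ μ ∈ B, branchWeight x k lam.rowLen μ.rowLen *
            stripWeight s k μ.rowLen κ.rowLen) * Polynomial.C (grothendieck κ.cells m) := by
          rw [Finset.sum_congr rfl hih]
          simp only [Finset.mul_sum, Finset.sum_mul]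
          rw [Finset.sum_comm]
          exact Finset.sum_congr rfl fun κ _ => Finset.sum_congr rfl fun μ _ => by ring
      _ = ∑ κ ∈ B, (∑ ν ∈ B, stripWeight s k lam.rowLen ν.rowLen *
            branchWeight x k ν.rowLen κ.rowLen) * Polynomial.C (grothendieck κ.cells m) :=
          (Finset.sum_congr rfl hcomm).symm
      _ = _ := by
          rw [Finset.sum_congr rfl fun ν hν => congrArg _ (hsplit ν hν)]
          simp only [Finset.mul_sum, Finset.sum_mul]
          rw [Finset.sum_comm]
          exact Finset.sum_congr rfl fun κ _ => Finset.sum_congr rfl fun μ _ => by ring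

theorem rect_zero_one : rect 0 1 = ⊥ := by
  ext c
  simp [rect]

theorem rowLen_rect_one (j i : ℕ) : (rect j 1).rowLen i = if i < j then 1 else 0 := by
  refine eq_of_forall_lt_iff fun c => ?_
  rw [← YoungDiagram.mem_iff_lt_rowLen, ← YoungDiagram.mem_cells]
  split_ifs with h <;> simp [rect, h, eq_comm]

theorem eq_rect_of_isVerticalStrip_bot {ν : YoungDiagram} (h : IsVerticalStrip ⊥ ν) :
    ν = rect (ν.colLen 0) 1 := by
  refine rowLen_injective (funext fun i => ?_)
  have h1 := h i
  have h2 := rowLen_eq_zero_iff (μ := ν) (i := i)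
  rw [rowLen_bot] at h1
  rw [rowLen_rect_one]
  split_ifs <;> omega

theorem stripWeight_bot_rect {A : Type*} [CommRing A] (s : A) {k j : ℕ} (hj : j ≤ k) :
    stripWeight s k (⊥ : YoungDiagram).rowLen (rect (j + 1) 1).rowLen = s * (1 + s) ^ j := by
  rw [stripWeight_eq s _ bot_le]
  · have h1 : (rect (j + 1) 1).cells = Finset.range (j + 1) ×ˢ Finset.range 1 := rfl
    rw [YoungDiagram.card, YoungDiagram.card, YoungDiagram.cells_bot, Finset.sdiff_empty, h1,
      Finset.product_image_snd (by simp)]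
    simp
  · intro i
    rw [rowLen_bot, rowLen_rect_one]
    split_ifs <;> simp
  · rw [rowLen_rect_one, if_neg (by omega)]

open Classical in
theorem prod_eq_one_add_sum (s : (MvPolynomial ℕ ℤ)[X]) {k m : ℕ} (hm : m ≤ k + 1) :
    ∏ i ∈ Finset.range m, (1 + Polynomial.C (MvPolynomial.X i) * s) =
      1 + s * ∑ j ∈ Finset.range (k + 1), (1 + s) ^ j * Polynomial.C (grothendieck (rect (j + 1) 1).cells m) := by
  have h := prod_mul_grothendieck s hm (rowLen_bot (k + 1)) (N := 1) (by simp [rowLen_bot])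
  rw [grothendieck_bot, map_one, mul_one] at h
  have hinj : Set.InjOn (rect · 1) (Finset.range (k + 2) : Set ℕ) := by
    intro i _ j _ hij
    have h1 := congrArg YoungDiagram.card hij
    simpa [rect, YoungDiagram.card] using h1
  have hsum : ∑ ν ∈ youngBox (k + 1) 1, stripWeight s k (⊥ : YoungDiagram).rowLen ν.rowLen *
        Polynomial.C (grothendieck ν.cells m) =
      ∑ j ∈ Finset.range (k + 2), stripWeight s k (⊥ : YoungDiagram).rowLen (rect j 1).rowLen *
        Polynomial.C (grothendieck (rect j 1).cells m) := by
    rw [← Finset.sum_image (g := (rect · 1)) hinj (f := fun ν : YoungDiagram =>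
      stripWeight s k (⊥ : YoungDiagram).rowLen ν.rowLen *
        Polynomial.C (grothendieck ν.cells m))]
    refine (Finset.sum_subset ?_ ?_).symm
    · intro ν hν
      obtain ⟨j, hj, rfl⟩ := Finset.mem_image.1 hν
      rw [Finset.mem_range] at hj
      rw [mem_youngBox, rowLen_rect_one, rowLen_rect_one]
      refine ⟨if_neg (by omega), ?_⟩
      split_ifs <;> simp
    · intro ν hν hν'
      rw [stripWeight_eq_zero s (rowLen_bot _) (mem_youngBox.1 hν).1, zero_mul]
      rintro ⟨-, hs⟩
      refine hν' (Finset.mem_image.2 ⟨ν.colLen 0, Finset.mem_range.2 ?_,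
        (eq_rect_of_isVerticalStrip_bot hs).symm⟩)
      have := rowLen_eq_zero_iff.1 (mem_youngBox.1 hν).1
      omega
  have hzero : stripWeight s k (⊥ : YoungDiagram).rowLen (⊥ : YoungDiagram).rowLen = 1 := by
    rw [stripWeight_eq s (rowLen_bot _) le_rfl fun i => Nat.le_succ _]
    simp
  rw [h, hsum, Finset.sum_range_succ', rect_zero_one, grothendieck_bot, hzero, map_one, mul_one,
    add_comm, Finset.mul_sum]
  refine congrArg _ (Finset.sum_congr rfl fun j hj => ?_)
  rw [stripWeight_bot_rect s (Nat.lt_succ_iff.1 (Finset.mem_range.1 hj)), mul_assoc]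

theorem coeff_X_sub_one_pow_mul_X_pow {R : Type*} [CommRing R] {c n l : ℕ} (hc : c ≤ n)
    (hc0 : 1 ≤ c) (hl : 1 ≤ l) :
    ((Polynomial.X - 1 : R[X]) ^ (c - 1) * Polynomial.X ^ (n - c)).coeff (l - 1) =
      if l ≤ n then (-1) ^ (n - l) * ((c - 1).choose (n - l) : R) else 0 := by
  have hX : (Polynomial.X - 1 : R[X]) = Polynomial.X + Polynomial.C (-1) := by simp [sub_eq_add_neg]
  rw [hX, Polynomial.coeff_mul_X_pow', Polynomial.coeff_X_add_C_pow]
  split_ifs with h1 h2 h2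
  · have h3 : c - 1 - (l - 1 - (n - c)) = n - l := by omega
    rw [← Nat.choose_symm (show l - 1 - (n - c) ≤ c - 1 by omega), h3]
  · rw [Nat.choose_eq_zero_of_lt (by omega), Nat.cast_zero, mul_zero]
  · rw [Nat.choose_eq_zero_of_lt (by omega), Nat.cast_zero, mul_zero]
  · rfl

theorem card_image_snd_pos {lam ν : YoungDiagram} (h : lam < ν) :
    0 < ((ν.cells \ lam.cells).image Prod.snd).card := by
  rw [Finset.card_pos, Finset.image_nonempty, Finset.sdiff_nonempty,
    YoungDiagram.cells_subset_iff]
  exact h.not_ge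

theorem card_image_snd_le {lam ν : YoungDiagram} (h : lam < ν) :
    ((ν.cells \ lam.cells).image Prod.snd).card ≤ ν.card - lam.card := by
  rw [YoungDiagram.card, YoungDiagram.card,
    ← Finset.card_sdiff_of_subset (YoungDiagram.cells_subset_iff.2 h.le)]
  exact Finset.card_image_le

open Classical in
theorem sum_rect_mul_grothendieck {k m : ℕ} (hm : m ≤ k + 1) {lam : YoungDiagram}
    (hlam : lam.rowLen (k + 1) = 0) :
    (∑ j ∈ Finset.range (k + 1), Polynomial.X ^ j * Polynomial.C (grothendieck (rect (j + 1) 1).cells m)) *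
        Polynomial.C (grothendieck lam.cells m) =
      ∑ ν ∈ youngBox (k + 1) (lam.rowLen 0 + 1) with lam < ν ∧ IsVerticalStrip lam ν,
        (Polynomial.X - 1) ^ (((ν.cells \ lam.cells).image Prod.snd).card - 1) *
          Polynomial.X ^ (ν.card - lam.card - ((ν.cells \ lam.cells).image Prod.snd).card) *
          Polynomial.C (grothendieck ν.cells m) := by
  have h := prod_mul_grothendieck (Polynomial.X - 1) hm hlam (Nat.lt_succ_self _)
  rw [prod_eq_one_add_sum _ hm, add_mul, one_mul, mul_assoc, add_sub_cancel] at h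
  have hmem : lam ∈ youngBox (k + 1) (lam.rowLen 0 + 1) := mem_youngBox.2 ⟨hlam, Nat.le_succ _⟩
  rw [← Finset.add_sum_erase _ _ hmem, stripWeight_eq _ hlam le_rfl fun i => Nat.le_succ _] at h
  simp only [sdiff_self, Finset.bot_eq_empty, Finset.image_empty, Finset.card_empty, pow_zero,
    Nat.sub_self, one_mul, add_right_inj] at h
  refine mul_left_cancel₀ (Polynomial.X_sub_C_ne_zero (1 : MvPolynomial ℕ ℤ)) ?_
  rw [map_one, h, Finset.mul_sum]
  refine (Finset.sum_subset_zero_on_sdiff ?_ ?_ ?_).symm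
  · intro ν hν
    rw [Finset.mem_filter] at hν
    exact Finset.mem_erase.2 ⟨hν.2.1.ne', hν.1⟩
  · intro ν hν
    rw [Finset.mem_sdiff, Finset.mem_erase, Finset.mem_filter] at hν
    rw [stripWeight_eq_zero _ hlam (mem_youngBox.1 hν.1.2).1, zero_mul]
    rintro ⟨h1, h2⟩
    exact hν.2 ⟨hν.1.2, lt_of_le_of_ne h1 hν.1.1.symm, h2⟩
  · intro ν hν
    rw [Finset.mem_filter, mem_youngBox] at hν
    obtain ⟨⟨h1, -⟩, h2, h3⟩ := hν
    have hpos : 0 < ((ν.cells \ lam.cells).image Prod.snd).card :=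
      (card_image_snd_pos h2)
    rw [stripWeight_eq _ h1 h2.le h3, add_sub_cancel, ← mul_assoc, ← mul_assoc, ← pow_succ',
      Nat.sub_add_cancel hpos]

end Pieri

/-- **Lenart's Pieri rule** (Corollary 4.4): for every partition `λ` and all
`ℓ, m ≥ 1`,
`G_{(1^ℓ)}(x_1,…,x_m) · G_λ(x_1,…,x_m)
  = Σ_ν (-1)^{|ν/λ|-ℓ} C(c(ν/λ)-1, |ν/λ|-ℓ) G_ν(x_1,…,x_m)`,
the sum being over all partitions `ν ⊋ λ` with at most `m` rows such that
`ν/λ` is a vertical strip with `|ν/λ| ≥ ℓ`; here `c(ν/λ)` is the number of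
nonempty columns of `ν/λ`. -/
theorem grothendieck_pieri (lam : YoungDiagram) (l m : ℕ) (hl : 1 ≤ l) (hm : 1 ≤ m) :
    grothendieck (rect l 1).cells m * grothendieck lam.cells m =
      ∑ᶠ (nu : YoungDiagram)
        (_ : lam < nu ∧ IsVerticalStrip lam nu ∧ l ≤ nu.card - lam.card ∧ nu.colLen 0 ≤ m),
        ((-1 : ℤ) ^ (nu.card - lam.card - l) *
            (Nat.choose (((nu.cells \ lam.cells).image Prod.snd).card - 1)
              (nu.card - lam.card - l) : ℤ)) • grothendieck nu.cells m := by
  classical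
  have hlam : lam.rowLen (max m (max l (lam.colLen 0)) + 1) = 0 :=
    rowLen_eq_zero_iff.2 (by omega)
  set k := max m (max l (lam.colLen 0)) with hk
  have hlk : l - 1 ∈ Finset.range (k + 1) := Finset.mem_range.2 (by omega)
  have h := congrArg (Polynomial.coeff · (l - 1))
    (sum_rect_mul_grothendieck (m := m) (show m ≤ k + 1 by omega) hlam)
  simp only [Polynomial.coeff_mul_C, Polynomial.finsetSum_coeff, Polynomial.coeff_X_pow] at h
  rw [Finset.sum_eq_single_of_mem _ hlk fun j _ hj => by rw [if_neg hj.symm, zero_mul],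
    if_pos rfl, one_mul, Nat.sub_add_cancel hl] at h
  rw [h, finsum_cond_eq_sum_of_cond_iff _
    (t := {ν ∈ {ν ∈ youngBox (k + 1) (lam.rowLen 0 + 1) | lam < ν ∧ IsVerticalStrip lam ν} |
      l ≤ ν.card - lam.card}), Finset.sum_filter (fun ν : YoungDiagram => l ≤ ν.card - lam.card)]
  · refine Finset.sum_congr rfl fun ν hν => ?_
    have hlt := (Finset.mem_filter.1 hν).2.1
    rw [coeff_X_sub_one_pow_mul_X_pow (card_image_snd_le hlt) (card_image_snd_pos hlt) hl]
    split_ifs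
    · simp [zsmul_eq_mul]
    · exact zero_mul _
  · intro ν hν
    have h0 : ν.rowLen m = 0 := by
      by_contra hne
      exact hν (by rw [grothendieck_eq_zero hne, smul_zero])
    have hcol := rowLen_eq_zero_iff.1 h0
    rw [Finset.mem_filter, Finset.mem_filter, mem_youngBox]
    constructor
    · rintro ⟨h1, h2, h3, -⟩
      exact ⟨⟨⟨rowLen_eq_zero_iff.2 (by omega), h2 0⟩, h1, h2⟩, h3⟩
    · rintro ⟨⟨-, h1, h2⟩, h3⟩
      exact ⟨h1, h2, h3, hcol⟩
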